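/- (Proposition 2, relation rt-10: reflection–reflection exchange for the dressed matrices.) With r(k) = L(k)R(k)L(−k)⁻¹, for all k₁,k₂ ∈ ℝ the following identity holds in M_{n²}(𝒜): S₁₂(k₁,k₂) r₁(k₁) S₂₁(k₂,−k₁) r₂(k₂) = r₂(k₂) S₁₂(k₁,−k₂) r₁(k₁) S₂₁(−k₂,−k₁), where r₁ = r⊗Iₙ, r₂ = Iₙ⊗r and the scalar matrices S₁₂, S₂₁ act entrywise on 𝒜. -/

import Mathlib

open scoped Matrix BigOperators

variable {n : ℕ}

/-- `[S₂₁(k₂,k₁)]^{(i,j)}_{(p,q)} = [S(k₂,k₁)]^{(j,i)}_{(q,p)}`. -/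
def S21 (S : ℝ → ℝ → Matrix (Fin n × Fin n) (Fin n × Fin n) ℂ) (k₂ k₁ : ℝ) :
    Matrix (Fin n × Fin n) (Fin n × Fin n) ℂ :=
  Matrix.of fun x y => S k₂ k₁ (x.2, x.1) (y.2, y.1)

/-- `M₁ = M ⊗ Iₙ`. -/
def leg1 {A : Type*} [Semiring A] [DecidableEq (Fin n)]
    (M : Matrix (Fin n) (Fin n) A) :
    Matrix (Fin n × Fin n) (Fin n × Fin n) A :=
  Matrix.of fun x y => if x.2 = y.2 then M x.1 y.1 else 0

/-- `M₂ = Iₙ ⊗ M`. -/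
def leg2 {A : Type*} [Semiring A] [DecidableEq (Fin n)]
    (M : Matrix (Fin n) (Fin n) A) :
    Matrix (Fin n × Fin n) (Fin n × Fin n) A :=
  Matrix.of fun x y => if x.1 = y.1 then M x.2 y.2 else 0

/-- entrywise embedding of a scalar `n² × n²` matrix into matrices over `𝒜`. -/
def emb (𝒜 : Type*) [Ring 𝒜] [Algebra ℂ 𝒜]
    (M : Matrix (Fin n × Fin n) (Fin n × Fin n) ℂ) :
    Matrix (Fin n × Fin n) (Fin n × Fin n) 𝒜 :=
  M.map (algebraMap ℂ 𝒜)

/-- entrywise embedding of a scalar `n × n` matrix into matrices over `𝒜`. -/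
def embn (𝒜 : Type*) [Ring 𝒜] [Algebra ℂ 𝒜] (M : Matrix (Fin n) (Fin n) ℂ) :
    Matrix (Fin n) (Fin n) 𝒜 :=
  M.map (algebraMap ℂ 𝒜)

/-- `W₁₂` acting on factors 1,2 of `(ℂⁿ)^{⊗3}`. -/
def leg12 (W : Matrix (Fin n × Fin n) (Fin n × Fin n) ℂ) :
    Matrix (Fin n × Fin n × Fin n) (Fin n × Fin n × Fin n) ℂ :=
  Matrix.of fun x y => if x.2.2 = y.2.2 then W (x.1, x.2.1) (y.1, y.2.1) else 0

/-- `W₁₃` acting on factors 1,3 of `(ℂⁿ)^{⊗3}`. -/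
def leg13 (W : Matrix (Fin n × Fin n) (Fin n × Fin n) ℂ) :
    Matrix (Fin n × Fin n × Fin n) (Fin n × Fin n × Fin n) ℂ :=
  Matrix.of fun x y => if x.2.1 = y.2.1 then W (x.1, x.2.2) (y.1, y.2.2) else 0

/-- `W₂₃` acting on factors 2,3 of `(ℂⁿ)^{⊗3}`. -/
def leg23 (W : Matrix (Fin n × Fin n) (Fin n × Fin n) ℂ) :
    Matrix (Fin n × Fin n × Fin n) (Fin n × Fin n × Fin n) ℂ :=
  Matrix.of fun x y => if x.1 = y.1 then W (x.2.1, x.2.2) (y.2.1, y.2.2) else 0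

section Legs

variable {A : Type*} [Semiring A]

lemma leg1_mul (M N : Matrix (Fin n) (Fin n) A) : leg1 (M * N) = leg1 M * leg1 N := by
  ext ⟨i, j⟩ ⟨p, q⟩
  by_cases h : j = q <;>
    simp [leg1, Matrix.mul_apply, Fintype.sum_prod_type, h]

lemma leg2_mul (M N : Matrix (Fin n) (Fin n) A) : leg2 (M * N) = leg2 M * leg2 N := by
  ext ⟨i, j⟩ ⟨p, q⟩
  by_cases h : i = p <;>
    simp [leg2, Matrix.mul_apply, Fintype.sum_prod_type, h]

lemma leg1_one : leg1 (1 : Matrix (Fin n) (Fin n) A) = 1 := by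
  ext ⟨i, j⟩ ⟨p, q⟩
  by_cases h : j = q <;> simp [leg1, Matrix.one_apply, h]

lemma leg2_one : leg2 (1 : Matrix (Fin n) (Fin n) A) = 1 := by
  ext ⟨i, j⟩ ⟨p, q⟩
  by_cases h : i = p <;> simp [leg2, Matrix.one_apply, h]

lemma leg1_mul_leg2_apply (M N : Matrix (Fin n) (Fin n) A) (x y : Fin n × Fin n) :
    (leg1 M * leg2 N) x y = M x.1 y.1 * N x.2 y.2 := by
  simp [leg1, leg2, Matrix.mul_apply, Fintype.sum_prod_type]

lemma leg2_mul_leg1_apply (M N : Matrix (Fin n) (Fin n) A) (x y : Fin n × Fin n) :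
    (leg2 N * leg1 M) x y = N x.2 y.2 * M x.1 y.1 := by
  simp [leg1, leg2, Matrix.mul_apply, Fintype.sum_prod_type]

/-- Matrices on different tensor factors commute as soon as their entries do. -/
lemma commute_leg1_leg2 {M N : Matrix (Fin n) (Fin n) A}
    (h : ∀ i p j q, Commute (M i p) (N j q)) : Commute (leg1 M) (leg2 N) := by
  ext x y
  rw [leg1_mul_leg2_apply, leg2_mul_leg1_apply, h]

end Legs

section Embedding

variable {𝒜 : Type*} [Ring 𝒜] [Algebra ℂ 𝒜]

lemma emb_mul (M N : Matrix (Fin n × Fin n) (Fin n × Fin n) ℂ) :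
    emb 𝒜 (M * N) = emb 𝒜 M * emb 𝒜 N :=
  Matrix.map_mul

lemma emb_leg1 (M : Matrix (Fin n) (Fin n) ℂ) : emb 𝒜 (leg1 M) = leg1 (embn 𝒜 M) := by
  ext x y
  simp [emb, embn, leg1, apply_ite (algebraMap ℂ 𝒜)]

lemma emb_leg2 (M : Matrix (Fin n) (Fin n) ℂ) : emb 𝒜 (leg2 M) = leg2 (embn 𝒜 M) := by
  ext x y
  simp [emb, embn, leg2, apply_ite (algebraMap ℂ 𝒜)]

lemma commute_leg1_embn_leg2 (M : Matrix (Fin n) (Fin n) ℂ) (N : Matrix (Fin n) (Fin n) 𝒜) :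
    Commute (leg1 (embn 𝒜 M)) (leg2 N) :=
  commute_leg1_leg2 fun i p j q => Algebra.commute_algebraMap_left (M i p) (N j q)

lemma commute_leg1_leg2_embn (M : Matrix (Fin n) (Fin n) ℂ) (N : Matrix (Fin n) (Fin n) 𝒜) :
    Commute (leg1 N) (leg2 (embn 𝒜 M)) :=
  commute_leg1_leg2 fun i p j q => Algebra.commute_algebraMap_right (M j q) (N i p)

/-- The RLL relation with the two tensor factors exchanged. -/
lemma emb_S21_mul_leg2_mul_leg1 {S : ℝ → ℝ → Matrix (Fin n × Fin n) (Fin n × Fin n) ℂ}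
    {L : ℝ → Matrix (Fin n) (Fin n) 𝒜}
    (hRLL : ∀ k₁ k₂, emb 𝒜 (S k₁ k₂) * leg1 (L k₁) * leg2 (L k₂) =
      leg2 (L k₂) * leg1 (L k₁) * emb 𝒜 (S k₁ k₂)) (k₂ k₁ : ℝ) :
    emb 𝒜 (S21 S k₂ k₁) * leg2 (L k₂) * leg1 (L k₁) =
      leg1 (L k₁) * leg2 (L k₂) * emb 𝒜 (S21 S k₂ k₁) := by
  have h := congrArg (Matrix.submatrix · (Equiv.prodComm (Fin n) (Fin n))
    (Equiv.prodComm (Fin n) (Fin n))) (hRLL k₂ k₁)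
  simp only [← Matrix.submatrix_mul_equiv _ _ _ (Equiv.prodComm (Fin n) (Fin n)) _] at h
  exact h

end Embedding

/-- Dressing a solution of the reflection equation in a monoid: `x, x', y, y'` play the roles of
`L₁(k₁), L₁(-k₁), L₂(k₂), L₂(-k₂)`, with `u` and `v` inverse to `x'` and `y'`. -/
lemma dressed_reflection_eq {M : Type*} [Monoid M]
    {s s' σ σ' x x' y y' u v ρ₁ ρ₂ : M}
    (hxu : x' * u = 1) (hux : u * x' = 1) (hyv : y' * v = 1) (hvy : v * y' = 1)
    (hs : s * x * y = y * x * s) (hs' : s' * x * y' = y' * x * s')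
    (hσ : σ * y * x' = x' * y * σ) (hσ' : σ' * y' * x' = x' * y' * σ')
    (hρ₁y : Commute ρ₁ y) (hρ₁v : Commute ρ₁ v) (hxρ₂ : Commute x ρ₂) (huρ₂ : Commute u ρ₂)
    (hρ : s * ρ₁ * σ * ρ₂ = ρ₂ * s' * ρ₁ * σ') :
    s * (x * ρ₁ * u) * σ * (y * ρ₂ * v) = y * ρ₂ * v * s' * (x * ρ₁ * u) * σ' := by
  have conj {b b' c d e : M} (hl : b' * b = 1) (hr : b * b' = 1)
      (h : c * d * b = b * d * e) : b' * c * d = d * e * b' := by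
    calc b' * c * d = b' * (c * d * b) * b' := by simp only [mul_assoc, hr, mul_one]
      _ = (b' * b) * d * e * b' := by rw [h]; simp only [mul_assoc]
      _ = d * e * b' := by rw [hl, one_mul]
  have h₁ : u * σ * y = y * σ * u := conj hux hxu hσ
  have h₂ : v * s' * x = x * s' * v := conj hvy hyv hs'
  have h₃ : v * u * σ' = σ' * u * v := by
    calc v * u * σ' = v * u * (σ' * (y' * (x' * u) * v)) := by
          rw [hxu, mul_one, hyv, mul_one]
      _ = v * u * (σ' * y' * x') * u * v := by simp only [mul_assoc]
      _ = v * (u * x') * y' * σ' * u * v := by rw [hσ']; simp only [mul_assoc]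
      _ = σ' * u * v := by rw [hux, mul_one, hvy, one_mul]
  calc s * (x * ρ₁ * u) * σ * (y * ρ₂ * v)
      = s * x * ρ₁ * (u * σ * y) * ρ₂ * v := by simp only [mul_assoc]
    _ = s * x * (ρ₁ * y) * σ * (u * ρ₂) * v := by rw [h₁]; simp only [mul_assoc]
    _ = (s * x * y) * ρ₁ * σ * ρ₂ * u * v := by
        rw [hρ₁y.eq, huρ₂.eq]; simp only [mul_assoc]
    _ = y * x * (s * ρ₁ * σ * ρ₂) * u * v := by rw [hs]; simp only [mul_assoc]
    _ = y * (x * ρ₂) * s' * ρ₁ * (σ' * u * v) := by rw [hρ]; simp only [mul_assoc]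
    _ = y * ρ₂ * x * s' * (ρ₁ * v) * u * σ' := by
        rw [hxρ₂.eq, ← h₃]; simp only [mul_assoc]
    _ = y * ρ₂ * (x * s' * v) * ρ₁ * u * σ' := by rw [hρ₁v.eq]; simp only [mul_assoc]
    _ = y * ρ₂ * v * s' * (x * ρ₁ * u) * σ' := by rw [← h₂]; simp only [mul_assoc]

theorem stmt_6
    (hn : 1 ≤ n)
    (S : ℝ → ℝ → Matrix (Fin n × Fin n) (Fin n × Fin n) ℂ)
    (hU : ∀ k₁ k₂, S k₁ k₂ * S21 S k₂ k₁ = 1)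
    (hYB : ∀ k₁ k₂ k₃,
      leg12 (S k₁ k₂) * leg13 (S k₁ k₃) * leg23 (S k₂ k₃) =
        leg23 (S k₂ k₃) * leg13 (S k₁ k₃) * leg12 (S k₁ k₂))
    (T R : ℝ → Matrix (Fin n) (Fin n) ℂ)
    (hT : ∀ k, (T k)ᴴ = T k)
    (hR : ∀ k, (R k)ᴴ = R (-k))
    (hTRu : ∀ k, T k * T k + R k * R (-k) = 1)
    (hTRz : ∀ k, T k * R k + R k * T (-k) = 0)
    (hbYB : ∀ k₁ k₂,
      S k₁ k₂ * leg1 (R k₁) * S21 S k₂ (-k₁) * leg2 (R k₂) =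
        leg2 (R k₂) * S k₁ (-k₂) * leg1 (R k₁) * S21 S (-k₂) (-k₁))
    (htYB : ∀ k₁ k₂,
      S k₁ k₂ * leg1 (T k₁) * S21 S k₂ k₁ * leg2 (T k₂) =
        leg2 (T k₂) * S k₁ k₂ * leg1 (T k₁) * S21 S k₂ k₁)
    (hrtYB : ∀ k₁ k₂,
      S k₁ k₂ * leg1 (T k₁) * S21 S k₂ k₁ * leg2 (R k₂) =
        leg2 (R k₂) * S k₁ (-k₂) * leg1 (T k₁) * S21 S (-k₂) k₁)
    (𝒜 : Type*) [Ring 𝒜] [Algebra ℂ 𝒜]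
    (a ad : ℝ → Fin n → 𝒜)
    (L Linv : ℝ → Matrix (Fin n) (Fin n) 𝒜)
    (hL : ∀ k, L k * Linv k = 1 ∧ Linv k * L k = 1)
    (hZF1 : ∀ k₁ k₂ (i j : Fin n), a k₁ i * a k₂ j =
      ∑ p, ∑ q, S21 S k₂ k₁ (i, j) (p, q) • (a k₂ q * a k₁ p))
    (hZF2 : ∀ k₁ k₂ (i j : Fin n), ad k₁ i * ad k₂ j =
      ∑ p, ∑ q, S21 S k₂ k₁ (p, q) (i, j) • (ad k₂ q * ad k₁ p))
    (hWB1 : ∀ k₁ k₂ (i l j : Fin n), L k₁ i l * a k₂ j =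
      ∑ p, ∑ q, S21 S k₂ k₁ (i, j) (p, q) • (a k₂ q * L k₁ p l))
    (hWB2 : ∀ k₁ k₂ (i l j : Fin n), L k₁ i l * ad k₂ j =
      ∑ p, ∑ q, S k₁ k₂ (i, p) (q, j) • (ad k₂ p * L k₁ q l))
    (hRLL : ∀ k₁ k₂,
      emb 𝒜 (S k₁ k₂) * leg1 (L k₁) * leg2 (L k₂) =
        leg2 (L k₂) * leg1 (L k₁) * emb 𝒜 (S k₁ k₂))
    (t r : ℝ → Matrix (Fin n) (Fin n) 𝒜)
    (ht : ∀ k, t k = L k * embn 𝒜 (T k) * Linv k)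
    (hr : ∀ k, r k = L k * embn 𝒜 (R k) * Linv (-k))
    :
    ∀ k₁ k₂,
      emb 𝒜 (S k₁ k₂) * leg1 (r k₁) * emb 𝒜 (S21 S k₂ (-k₁)) * leg2 (r k₂) =
        leg2 (r k₂) * emb 𝒜 (S k₁ (-k₂)) * leg1 (r k₁) * emb 𝒜 (S21 S (-k₂) (-k₁)) := by
  intro k₁ k₂
  have hbYB_emb := congrArg (emb 𝒜) (hbYB k₁ k₂)
  simp only [emb_mul, emb_leg1, emb_leg2] at hbYB_emb
  simp only [hr, leg1_mul, leg2_mul]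
  refine dressed_reflection_eq (x' := leg1 (L (-k₁))) (y' := leg2 (L (-k₂))) ?_ ?_ ?_ ?_
    (hRLL k₁ k₂) (hRLL k₁ (-k₂)) (emb_S21_mul_leg2_mul_leg1 hRLL k₂ (-k₁))
    (emb_S21_mul_leg2_mul_leg1 hRLL (-k₂) (-k₁))
    (commute_leg1_embn_leg2 _ _) (commute_leg1_embn_leg2 _ _)
    (commute_leg1_leg2_embn _ _) (commute_leg1_leg2_embn _ _) hbYB_emb
  · rw [← leg1_mul, (hL _).1, leg1_one]
  · rw [← leg1_mul, (hL _).2, leg1_one]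
  · rw [← leg2_mul, (hL _).1, leg2_one]
  · rw [← leg2_mul, (hL _).2, leg2_one]
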